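/- Noether theorem for higher-order Lagrangians (direct part, even version): let X : (ℝⁿ)^{2k} → ℝⁿ and F : (ℝⁿ)^{3k−1} → ℝ be smooth maps such that for every smooth curve q : ℝ → ℝⁿ and every t ∈ ℝ, Σ_{j=0}^{k} ⟨∂_j L(j_k q(t)), (d/dt)^j [ X(j_{2k−1} q(s)) ](t)⟩ = (d/dt)[ F(j_{3k−2} q(s)) ](t) (X is a generalized infinitesimal symmetry of L with associated function F). Then for every solution q of the Euler–Lagrange equations, the function t ↦ Σ_{j=0}^{k−1} ⟨p_q^{(j)}(t), (d/dt)^j [ X(j_{2k−1} q(s)) ](t)⟩ − F(j_{3k−2} q(t)) is constant on ℝ. -/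

import Mathlib

open RealInnerProductSpace

noncomputable section

/-- The model space ℝⁿ. -/
abbrev E (n : ℕ) := EuclideanSpace ℝ (Fin n)

/-- The `m`-jet of a curve `q : ℝ → ℝⁿ`:  `jet q m t = (q t, q' t, …, q⁽ᵐ⁾ t)`. -/
def jet {n : ℕ} (q : ℝ → E n) (m : ℕ) : ℝ → (Fin (m + 1) → E n) :=
  fun t i => iteratedDeriv i q t

/-- The partial gradient `∂_j L` of `L : (ℝⁿ)^{k+1} → ℝ` with respect to its `j`-th slot,
characterized by `⟪∂_j L x, v⟫ = DL x (0, …, v, …, 0)` (with `v` in slot `j`). -/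
def pgrad {n k : ℕ} (L : (Fin (k + 1) → E n) → ℝ) (j : Fin (k + 1))
    (x : Fin (k + 1) → E n) : E n :=
  gradient (fun v => L (Function.update x j v)) (x j)

/-- The Euler–Lagrange expression of `L` along the curve `q`:
`E_q t = ∑_{j=0}^{k} (−1)^j (d/dt)^j [∂_j L (j_k q s)] t`. -/
def EL {n k : ℕ} (L : (Fin (k + 1) → E n) → ℝ) (q : ℝ → E n) (t : ℝ) : E n :=
  ∑ j : Fin (k + 1),
    (-1 : ℝ) ^ (j : ℕ) • iteratedDeriv j (fun s => pgrad L j (jet q k s)) t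

/-- `q` is a solution of the Euler–Lagrange equations of `L`. -/
def IsELSolution {n k : ℕ} (L : (Fin (k + 1) → E n) → ℝ) (q : ℝ → E n) : Prop :=
  ∀ t : ℝ, EL L q t = 0

/-- The `j`-th Jacobi–Ostrogradski momentum along `q`:
`p_q^{(j)} t = ∑_{l=0}^{k−1−j} (−1)^l (d/dt)^l [∂_{j+l+1} L (j_k q s)] t`. -/
def mom {n k : ℕ} (L : (Fin (k + 1) → E n) → ℝ) (q : ℝ → E n) (j : Fin k) (t : ℝ) : E n :=
  ∑ l : Fin (k - (j : ℕ)),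
    (-1 : ℝ) ^ (l : ℕ) •
      iteratedDeriv l
        (fun s => pgrad L ⟨(j : ℕ) + (l : ℕ) + 1, by
          have h1 := l.isLt; have h2 := j.isLt; omega⟩ (jet q k s)) t

/-- The Hessian of `L` in its last slot, as a (continuous) linear map `ℝⁿ → ℝⁿ`:
`⟪H_L x u, v⟫ = D²L x ((0,…,0,u), (0,…,0,v))`. -/
def hessLast {n k : ℕ} (L : (Fin (k + 1) → E n) → ℝ) (x : Fin (k + 1) → E n) :
    E n →L[ℝ] E n :=
  fderiv ℝ (fun v => pgrad L (Fin.last k) (Function.update x (Fin.last k) v))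
    (x (Fin.last k))

/-- `L` is regular if the Hessian in its last slot is invertible at every point. -/
def Regular {n k : ℕ} (L : (Fin (k + 1) → E n) → ℝ) : Prop :=
  ∀ x : Fin (k + 1) → E n, Function.Bijective (hessLast L x)

/-- `G : (ℝⁿ)^{2k} → ℝ` is a constant of motion of `L`. -/
def IsConstantOfMotion {n k : ℕ} (L : (Fin (k + 1) → E n) → ℝ)
    (G : (Fin (2 * k - 1 + 1) → E n) → ℝ) : Prop :=
  ∀ q : ℝ → E n, ContDiff ℝ (⊤ : ℕ∞) q → IsELSolution L q →
    ∃ c : ℝ, ∀ t : ℝ, G (jet q (2 * k - 1) t) = c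

/-- All iterated derivatives of a smooth curve are smooth. -/
theorem contDiff_infty_iteratedDeriv {V : Type*} [NormedAddCommGroup V] [NormedSpace ℝ V]
    {f : ℝ → V} (hf : ContDiff ℝ (⊤ : ℕ∞) f) (m : ℕ) :
    ContDiff ℝ (⊤ : ℕ∞) (iteratedDeriv m f) := by
  rw [iteratedDeriv_eq_iterate]
  exact hf.iterate_deriv m

theorem hasDerivAt_iteratedDeriv {V : Type*} [NormedAddCommGroup V] [NormedSpace ℝ V]
    {f : ℝ → V} (hf : ContDiff ℝ (⊤ : ℕ∞) f) (m : ℕ) (t : ℝ) :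
    HasDerivAt (iteratedDeriv m f) (iteratedDeriv (m + 1) f t) t := by
  rw [iteratedDeriv_succ]
  exact ((contDiff_infty_iteratedDeriv hf m).differentiable (by simp) t).hasDerivAt

theorem contDiff_jet {n : ℕ} {q : ℝ → E n} (hq : ContDiff ℝ (⊤ : ℕ∞) q) (m : ℕ) :
    ContDiff ℝ (⊤ : ℕ∞) (jet q m) :=
  contDiff_pi.2 fun i => contDiff_infty_iteratedDeriv hq i

theorem contDiff_pgrad {n k : ℕ} {L : (Fin (k + 1) → E n) → ℝ}
    (hL : ContDiff ℝ (⊤ : ℕ∞) L) (j : Fin (k + 1)) :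
    ContDiff ℝ (⊤ : ℕ∞) (pgrad L j) := by
  have key : pgrad L j = fun x => (InnerProductSpace.toDual ℝ (E n)).symm
      ((fderiv ℝ L x).comp (ContinuousLinearMap.single ℝ (fun _ => E n) j)) := by
    funext x
    have h1 : HasFDerivAt L (fderiv ℝ L x) (Function.update x j (x j)) := by
      rw [Function.update_eq_self]
      exact (hL.differentiable (by simp) x).hasFDerivAt
    have h2 := h1.comp (x j) (hasFDerivAt_update x (x j))
    have h3 : fderiv ℝ (fun v => L (Function.update x j v)) (x j) =
        (fderiv ℝ L x).comp (ContinuousLinearMap.single ℝ (fun _ => E n) j) := by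
      refine h2.fderiv.trans ?_
      congr 1
      ext v i
      by_cases h : i = j
      · subst h; simp
      · simp [h]
    rw [← h3]
    rfl
  rw [key]
  refine (LinearIsometryEquiv.contDiff _).comp ?_
  exact (hL.fderiv_right (by simp)).clm_comp contDiff_const

/-- The alternating sum `∑_{l=0}^{k-j} (-1)^l (d/dt)^l P_{j+l}`; it is the Euler–Lagrange
expression for `j = 0` and the momentum of index `j - 1` for `0 < j ≤ k`. -/
def altDerivSum {V : Type*} [NormedAddCommGroup V] [NormedSpace ℝ V]
    (k : ℕ) (P : ℕ → ℝ → V) (j : ℕ) (t : ℝ) : V :=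
  ∑ l ∈ Finset.range (k + 1 - j), (-1 : ℝ) ^ l • iteratedDeriv l (P (j + l)) t

theorem hasDerivAt_altDerivSum {V : Type*} [NormedAddCommGroup V] [NormedSpace ℝ V]
    {k : ℕ} {P : ℕ → ℝ → V} (hP : ∀ j, ContDiff ℝ (⊤ : ℕ∞) (P j)) {j : ℕ} (hj : j < k + 1)
    (t : ℝ) :
    HasDerivAt (altDerivSum k P (j + 1)) (P j t - altDerivSum k P j t) t := by
  have h : HasDerivAt (altDerivSum k P (j + 1))
      (∑ l ∈ Finset.range (k + 1 - (j + 1)),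
        (-1 : ℝ) ^ l • iteratedDeriv (l + 1) (P (j + 1 + l)) t) t :=
    HasDerivAt.fun_sum fun l _ => (hasDerivAt_iteratedDeriv (hP _) l t).const_smul _
  convert h using 1
  rw [altDerivSum, show k + 1 - j = k + 1 - (j + 1) + 1 by lia, Finset.sum_range_succ']
  simp only [pow_succ, mul_neg, mul_one, neg_smul, Finset.sum_neg_distrib, pow_zero, one_smul,
    iteratedDeriv_zero, add_zero, sub_add_cancel_right, neg_neg, show ∀ l, j + 1 + l = j + (l + 1)
      by lia]

/-- The higher-order integration by parts formula. -/
theorem hasDerivAt_sum_inner_altDerivSum {V : Type*} [NormedAddCommGroup V]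
    [InnerProductSpace ℝ V] {k : ℕ} {P : ℕ → ℝ → V} (hP : ∀ j, ContDiff ℝ (⊤ : ℕ∞) (P j))
    {Y : ℝ → V} (hY : ContDiff ℝ (⊤ : ℕ∞) Y) (t : ℝ) :
    HasDerivAt (fun s => ∑ j ∈ Finset.range k, ⟪altDerivSum k P (j + 1) s, iteratedDeriv j Y s⟫)
      (∑ j ∈ Finset.range (k + 1), ⟪P j t, iteratedDeriv j Y t⟫ - ⟪altDerivSum k P 0 t, Y t⟫)
      t := by
  have h : HasDerivAt
      (fun s => ∑ j ∈ Finset.range k, ⟪altDerivSum k P (j + 1) s, iteratedDeriv j Y s⟫)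
      (∑ j ∈ Finset.range k, (⟪altDerivSum k P (j + 1) t, iteratedDeriv (j + 1) Y t⟫ +
        ⟪P j t - altDerivSum k P j t, iteratedDeriv j Y t⟫)) t :=
    HasDerivAt.fun_sum fun j hj =>
      (hasDerivAt_altDerivSum hP (Nat.lt_succ_of_lt (Finset.mem_range.1 hj)) t).inner ℝ
        (hasDerivAt_iteratedDeriv hY j t)
  refine h.congr_deriv ?_
  have tele := Finset.sum_range_sub (fun j => ⟪altDerivSum k P j t, iteratedDeriv j Y t⟫) k
  have last : altDerivSum k P k t = P k t := by simp [altDerivSum]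
  simp only [last, iteratedDeriv_zero, Finset.sum_sub_distrib] at tele
  simp only [inner_sub_left, Finset.sum_add_distrib, Finset.sum_sub_distrib,
    Finset.sum_range_succ]
  linarith

/-- **Noether theorem for higher-order Lagrangians (direct part, even version).**
If `X : (ℝⁿ)^{2k} → ℝⁿ` and `F : (ℝⁿ)^{3k−1} → ℝ` are smooth and `X` is a generalized
infinitesimal symmetry of `L` with associated function `F`, then along every solution `q`
of the Euler–Lagrange equations the Noether function
`t ↦ ∑_{j=0}^{k−1} ⟪p_q^{(j)} t, (d/dt)^j [X (j_{2k−1} q s)] t⟫ − F (j_{3k−2} q t)`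
is constant on `ℝ`. -/
theorem noether_direct
    (n k : ℕ) (hn : 1 ≤ n) (hk : 1 ≤ k)
    (L : (Fin (k + 1) → E n) → ℝ) (hL : ContDiff ℝ (⊤ : ℕ∞) L)
    (X : (Fin (2 * k - 1 + 1) → E n) → E n) (hX : ContDiff ℝ (⊤ : ℕ∞) X)
    (F : (Fin (3 * k - 2 + 1) → E n) → ℝ) (hF : ContDiff ℝ (⊤ : ℕ∞) F)
    (hsym : ∀ q : ℝ → E n, ContDiff ℝ (⊤ : ℕ∞) q → ∀ t : ℝ,
      ∑ j : Fin (k + 1),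
          ⟪pgrad L j (jet q k t),
            iteratedDeriv j (fun s => X (jet q (2 * k - 1) s)) t⟫ =
        deriv (fun s => F (jet q (3 * k - 2) s)) t) :
    ∀ q : ℝ → E n, ContDiff ℝ (⊤ : ℕ∞) q → IsELSolution L q →
      ∃ c : ℝ, ∀ t : ℝ,
        (∑ j : Fin k,
            ⟪mom L q j t, iteratedDeriv j (fun s => X (jet q (2 * k - 1) s)) t⟫) -
          F (jet q (3 * k - 2) t) = c := by
  intro q hq hEL
  let P : ℕ → ℝ → E n := fun j s =>
    if h : j < k + 1 then pgrad L ⟨j, h⟩ (jet q k s) else 0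
  have hPj : ∀ (j : ℕ) (h : j < k + 1), P j = fun s => pgrad L ⟨j, h⟩ (jet q k s) :=
    fun j h => by funext s; simp only [P, dif_pos h]
  have hP : ∀ j, ContDiff ℝ (⊤ : ℕ∞) (P j) := fun j => by
    by_cases h : j < k + 1
    · rw [hPj j h]
      exact (contDiff_pgrad hL _).comp (contDiff_jet hq k)
    · simp only [P, dif_neg h]
      exact contDiff_const
  have hY : ContDiff ℝ (⊤ : ℕ∞) fun s => X (jet q (2 * k - 1) s) :=
    hX.comp (contDiff_jet hq _)
  have hFq : ContDiff ℝ (⊤ : ℕ∞) fun s => F (jet q (3 * k - 2) s) :=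
    hF.comp (contDiff_jet hq _)
  have hEL' : ∀ t, altDerivSum k P 0 t = 0 := fun t => by
    rw [← hEL t, altDerivSum, EL, Nat.sub_zero, Finset.sum_range]
    refine Finset.sum_congr rfl fun l _ => ?_
    rw [zero_add, hPj l l.isLt]
  have hmom : ∀ (j : Fin k) (t : ℝ), mom L q j t = altDerivSum k P (j + 1) t := fun j t => by
    rw [altDerivSum, mom, Nat.add_sub_add_right, Finset.sum_range]
    refine Finset.sum_congr rfl fun l _ => ?_
    rw [hPj (j + 1 + l) (by lia)]
    simp only [Nat.add_right_comm (j : ℕ) 1 l]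
  have hderiv : ∀ t, HasDerivAt (fun t => (∑ j : Fin k,
      ⟪mom L q j t, iteratedDeriv j (fun s => X (jet q (2 * k - 1) s)) t⟫) -
        F (jet q (3 * k - 2) t)) 0 t := fun t => by
    have h := (hasDerivAt_sum_inner_altDerivSum (k := k) hP hY t).fun_sub
      (hFq.differentiable (by simp) t).hasDerivAt
    rw [← hsym q hq t, hEL', inner_zero_left, sub_zero] at h
    simp only [hmom]
    simp only [Finset.sum_range] at h
    refine h.congr_deriv (sub_eq_zero.2 (Finset.sum_congr rfl fun j _ => ?_))
    rw [hPj j j.isLt]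
  exact ⟨_, fun t => is_const_of_deriv_eq_zero (fun t => (hderiv t).differentiableAt)
    (fun t => (hderiv t).deriv) t 0⟩
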